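/- Let n ≥ 3 be an integer and p ∈ (n, n+1]. Then for every z ≥ 1 and every x ≥ z one has ψ(z,x) ≤ 0. -/

import Mathlib

/-- `f(t) = t²/2 - tᵖ/p`. -/
noncomputable def f (p t : ℝ) : ℝ := t ^ 2 / 2 - t ^ p / p

/-- First derivative: `f'(t) = t - t^(p-1)`. -/
noncomputable def f' (p t : ℝ) : ℝ := t - t ^ (p - 1)

/-- Second derivative: `f''(t) = 1 - (p-1) t^(p-2)`. -/
noncomputable def f'' (p t : ℝ) : ℝ := 1 - (p - 1) * t ^ (p - 2)

/-- `ψ(z,x) = -f'(x)² - 3 f'(z) (f'(x) + (z-x) f''(x))`. -/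
noncomputable def ψ (p z x : ℝ) : ℝ :=
  -(f' p x) ^ 2 - 3 * f' p z * (f' p x + (z - x) * f'' p x)

/-- `r ^ q * exp (q (1 - r)) ≤ 1`, from `log r ≤ r - 1`. -/
theorem rpow_mul_exp_le_one {r q : ℝ} (hr : 0 < r) (hq : 0 ≤ q) :
    r ^ q * Real.exp (q * (1 - r)) ≤ 1 := by
  rw [Real.rpow_def_of_pos hr, ← Real.exp_add, Real.exp_le_one_iff]
  nlinarith [mul_le_mul_of_nonneg_left (Real.log_le_sub_one_of_pos hr) hq]

theorem three_mul_rpow_mul_le_one {r q : ℝ} (hr : 0 < r) (hq : 0 ≤ q) :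
    3 * r ^ q * (q * (1 - r) - 1) ≤ 1 := by
  have hE : 3 * (q * (1 - r) - 1) ≤ Real.exp (q * (1 - r)) := by
    have h1 : Real.exp (q * (1 - r)) = Real.exp (q * (1 - r) - 2) * Real.exp 2 := by
      rw [← Real.exp_add]; ring_nf
    have h2 := Real.add_one_le_exp (q * (1 - r) - 2)
    have h3 := Real.add_one_le_exp (2 : ℝ)
    have h4 := Real.exp_pos (q * (1 - r) - 2)
    nlinarith
  nlinarith [rpow_mul_exp_le_one hr hq, mul_le_mul_of_nonneg_left hE (Real.rpow_pos_of_pos hr q).le]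

theorem three_mul_rpow_mul_le_two {r q : ℝ} (hr : 0 < r) (hq : 0 ≤ q) :
    3 * r ^ q * (q * (1 - r)) ≤ 2 := by
  have hE : 3 * (q * (1 - r)) ≤ 2 * Real.exp (q * (1 - r)) := by
    have h1 : Real.exp (q * (1 - r)) = Real.exp (q * (1 - r) - 1) * Real.exp 1 := by
      rw [← Real.exp_add]; ring_nf
    have h2 := Real.add_one_le_exp (q * (1 - r) - 1)
    have h3 := Real.add_one_le_exp (1 : ℝ)
    have h4 := Real.exp_pos (q * (1 - r) - 1)
    nlinarith
  nlinarith [rpow_mul_exp_le_one hr hq, mul_le_mul_of_nonneg_left hE (Real.rpow_pos_of_pos hr q).le]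

theorem three_mul_mul_le_sq {P a r m w b : ℝ} (hP : 0 ≤ P) (hm : 0 ≤ m) (hmw : m ≤ w)
    (hb : b ≤ r * m) (har : 0 ≤ a + r) (h1 : 3 * P * a ≤ 1) (h2 : 3 * P * (a + r) ≤ 2) :
    3 * P * ((w - m) * (w * a + b)) ≤ w ^ 2 := by
  have hwm : 0 ≤ w - m := sub_nonneg.2 hmw
  have hle : (w - m) * (w * a + b) ≤ (w - m) * (w * a + r * m) := by gcongr
  rcases le_total r a with h | h
  · have ha : 0 ≤ a := by linarith
    have h3 : (w - m) * (w * a + r * m) ≤ a * w ^ 2 := by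
      nlinarith [mul_nonneg hwm (mul_nonneg (sub_nonneg.2 h) hm), mul_nonneg ha (sq_nonneg m)]
    calc 3 * P * ((w - m) * (w * a + b)) ≤ 3 * P * (a * w ^ 2) := by
          exact mul_le_mul_of_nonneg_left (hle.trans h3) (by positivity)
      _ = (3 * P * a) * w ^ 2 := by ring
      _ ≤ 1 * w ^ 2 := by gcongr
      _ = w ^ 2 := one_mul _
  · have h3 : (w - m) * (w * a + r * m) ≤ (a + r) / 2 * w ^ 2 := by
      nlinarith [mul_nonneg (sub_nonneg.2 h) (sq_nonneg (w - m)), mul_nonneg har (sq_nonneg m)]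
    calc 3 * P * ((w - m) * (w * a + b)) ≤ 3 * P * ((a + r) / 2 * w ^ 2) := by
          exact mul_le_mul_of_nonneg_left (hle.trans h3) (by positivity)
      _ = (3 * P * (a + r)) * (w ^ 2 / 2) := by ring
      _ ≤ 2 * (w ^ 2 / 2) := by gcongr
      _ = w ^ 2 := by ring

/-- The inequality `ψ ≤ 0` divided by `x ^ 2`, with `r = z / x` and `u = x ^ (q - 1)`. -/
theorem three_mul_rescaled_le_sq {q r u : ℝ} (hq : 2 ≤ q) (hr : 0 < r) (hr1 : r ≤ 1)
    (hu : 1 ≤ u * r ^ (q - 1)) :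
    3 * (r * (u * r ^ (q - 1) - 1)) * ((1 - r) * (q * u - 1) - (u - 1)) ≤ (u - 1) ^ 2 := by
  have hs : 0 < r ^ (q - 1) := Real.rpow_pos_of_pos hr _
  have hrs : r ^ q = r * r ^ (q - 1) := by
    rw [mul_comm, ← Real.rpow_add_one hr.ne', sub_add_cancel]
  have hB : 1 + (q - 1) * (r⁻¹ - 1) ≤ (r ^ (q - 1))⁻¹ := by
    have h := one_add_mul_self_le_rpow_one_add (s := r⁻¹ - 1) (p := q - 1)
      (by linarith [inv_pos.2 hr]) (by linarith)
    rwa [add_sub_cancel, Real.inv_rpow hr.le] at h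
  have hri : 1 ≤ r⁻¹ := (one_le_inv₀ hr).2 hr1
  have hss : r ^ (q - 1) * (r ^ (q - 1))⁻¹ = 1 := mul_inv_cancel₀ hs.ne'
  have hm : 0 ≤ (r ^ (q - 1))⁻¹ - 1 := by
    nlinarith [mul_nonneg (by linarith : 0 ≤ q - 1) (sub_nonneg.2 hri)]
  have hmw : (r ^ (q - 1))⁻¹ ≤ u := by rwa [inv_le_iff_one_le_mul₀ hs]
  have hb : (q - 1) * (1 - r) ≤ r * ((r ^ (q - 1))⁻¹ - 1) := by
    have h := mul_le_mul_of_nonneg_left hB hr.le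
    have h' : r * r⁻¹ = 1 := mul_inv_cancel₀ hr.ne'
    linear_combination h - (q - 1) * h'
  have hP := Real.rpow_pos_of_pos hr q
  have h2 := three_mul_rpow_mul_le_two hr (by linarith : 0 ≤ q)
  have key := three_mul_mul_le_sq (P := r ^ q) (a := q * (1 - r) - 1) (w := u - 1)
    hP.le hm (by linarith) hb (by nlinarith)
    (three_mul_rpow_mul_le_one hr (by linarith)) (by nlinarith)
  rw [hrs] at key
  linear_combination key + 3 * r * ((1 - r) * (q * u - 1) - (u - 1)) * hss

/-- let `n ≥ 3` be an integer and `p ∈ (n, n+1]`. Then for every `z ≥ 1`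
and every `x ≥ z`, `ψ(z,x) ≤ 0`. -/
theorem stmt_4 (n : ℕ) (hn : 3 ≤ n) (p : ℝ) (hp1 : (n : ℝ) < p) (hp2 : p ≤ (n : ℝ) + 1)
    (z x : ℝ) (hz : 1 ≤ z) (hx : z ≤ x) :
    ψ p z x ≤ 0 := by
  have hn' : (3 : ℝ) ≤ n := by exact_mod_cast hn
  have hz0 : 0 < z := by linarith
  have hx0 : 0 < x := by linarith
  have pow_succ' {t : ℝ} (ht : 0 < t) : t ^ (p - 1) = t * t ^ (p - 1 - 1) := by
    rw [mul_comm, ← Real.rpow_add_one ht.ne', sub_add_cancel]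
  have hzx : z = x * (z / x) := by field_simp
  have hv : z ^ (p - 1 - 1) = x ^ (p - 1 - 1) * (z / x) ^ (p - 1 - 1) := by
    rw [← Real.mul_rpow hx0.le (by positivity), ← hzx]
  have hv1 : 1 ≤ z ^ (p - 1 - 1) := Real.one_le_rpow hz (by linarith)
  have key := three_mul_rescaled_le_sq (q := p - 1) (r := z / x) (u := x ^ (p - 1 - 1))
    (by linarith) (by positivity) ((div_le_one hx0).2 hx) (hv ▸ hv1)
  rw [← hv] at key
  have key' := mul_le_mul_of_nonneg_left key (sq_nonneg x)
  have hp : p - 2 = p - 1 - 1 := by ring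
  simp only [ψ, f', f'']
  rw [hp, pow_succ' hx0, pow_succ' hz0]
  generalize z ^ (p - 1 - 1) = v at *
  generalize x ^ (p - 1 - 1) = u at *
  generalize z / x = r at *
  subst hzx
  linear_combination key'
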